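/- Let s ≥ 3 and let G be a bipartite graph with parts V₁ and V₂ such that |V₁| = s²−1, |V₂| = s³−s, every vertex of V₁ has degree s², every vertex of V₂ has degree s, and G has diameter 3. Then there exist two distinct vertices v, v' ∈ V₁ such that |N(v) ∩ N(v')| ≥ 3. -/

import Mathlib

/-- If `s ≥ 3` and `G` is a bipartite graph with parts `V1` (size `s²-1`, degrees `s²`) and
`V2` (size `s³-s`, degrees `s`) of diameter 3, then some two distinct vertices of `V1`
have at least 3 common neighbours. -/
theorem stmt_3 {V : Type*} [Fintype V] [DecidableEq V] (G : SimpleGraph V)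
    [DecidableRel G.Adj]
    (V1 V2 : Finset V) (s : ℕ) (hs : 3 ≤ s)
    (hpart : ∀ v : V, v ∈ V1 ↔ v ∉ V2)
    (hbip : ∀ u v : V, G.Adj u v → (u ∈ V1 ∧ v ∈ V2) ∨ (u ∈ V2 ∧ v ∈ V1))
    (hcard1 : V1.card = s ^ 2 - 1) (hcard2 : V2.card = s ^ 3 - s)
    (hdeg1 : ∀ v ∈ V1, G.degree v = s ^ 2)
    (hdeg2 : ∀ v ∈ V2, G.degree v = s)
    (hdiam : G.diam = 3) :
    ∃ v ∈ V1, ∃ v' ∈ V1, v ≠ v' ∧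
      3 ≤ (G.neighborFinset v ∩ G.neighborFinset v').card := by
  have hsq : 9 ≤ s ^ 2 := by nlinarith
  obtain ⟨v, hv⟩ : V1.Nonempty := Finset.card_pos.mp (by omega)
  by_contra! hcon
  have hcount : (G.neighborFinset v).card * (s - 1) ≤ (V1.erase v).card * 2 := by
    refine Finset.card_mul_le_card_mul G.Adj (fun w hw ↦ ?_) (fun v' hv' ↦ ?_)
    · rw [G.mem_neighborFinset] at hw
      have hw2 : w ∈ V2 := by
        rcases hbip v w hw with h | h
        · exact h.2
        · exact absurd h.1 ((hpart v).mp hv)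
      rw [← hdeg2 w hw2, ← G.card_neighborFinset_eq_degree,
        ← Finset.card_erase_of_mem ((G.mem_neighborFinset w v).mpr hw.symm)]
      refine Finset.card_le_card fun u hu ↦ ?_
      rw [Finset.mem_erase, G.mem_neighborFinset] at hu
      have hu1 : u ∈ V1 := by
        rcases hbip w u hu.2 with h | h
        · exact absurd hw2 ((hpart w).mp h.1)
        · exact h.2
      exact (Finset.mem_bipartiteAbove G.Adj).mpr ⟨Finset.mem_erase.mpr ⟨hu.1, hu1⟩, hu.2⟩
    · rw [Finset.mem_erase] at hv'
      refine (Finset.card_le_card fun w hw ↦ ?_).trans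
        (Nat.le_of_lt_succ (hcon v hv v' hv'.2 hv'.1.symm))
      rw [Finset.mem_bipartiteBelow] at hw
      exact Finset.mem_inter.mpr ⟨hw.1, (G.mem_neighborFinset v' w).mpr hw.2.symm⟩
  rw [G.card_neighborFinset_eq_degree, hdeg1 v hv, Finset.card_erase_of_mem hv, hcard1] at hcount
  have hmul : s ^ 2 * 2 ≤ s ^ 2 * (s - 1) := Nat.mul_le_mul_left _ (by omega)
  omega
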